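/- Fix cog ∈ C with cog ≤ cog*. Let V : ℤ × C → ℝ satisfy the value-bound property with constants t_s, t_max, ρ. Assume E[τ|cog,H] > E[τ|cog,N] and that E[τ|cog,H] − E[τ|cog,N] + t_s·γ^{E[τ|cog,H]}/(1 − γ^{t_max}) ≥ (t_max/(1−ρ))·E[γ^τ|cog,N]. Then the map q ↦ Q_V(q,cog,N) − Q_V(q,cog,H) is nondecreasing on ℤ; consequently, if Q_V(q₁,cog,N) > Q_V(q₁,cog,H) for some q₁, then Q_V(q₂,cog,N) > Q_V(q₂,cog,H) for every q₂ ≥ q₁, i.e., there is a threshold q₁*(cog) above which action N strictly dominates action H. -/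

import Mathlib

open scoped BigOperators

namespace Fidelity

/-- The actions available to the human operator: skip, rest, normal fidelity, high fidelity. -/
inductive Action : Type
  | S | R | N | H
deriving DecidableEq

/-- Admissible action set: `{S, N, H}` for `cog ≤ cog*` and `{S, R, N, H}` for `cog > cog*`. -/
def Act {C : Type*} [LinearOrder C] (cogStar cog : C) : Finset Action :=
  if cog ≤ cogStar then {Action.S, Action.N, Action.H}
  else {Action.S, Action.R, Action.N, Action.H}

lemma Act_nonempty {C : Type*} [LinearOrder C] (cogStar cog : C) :
    (Act cogStar cog).Nonempty := by
  unfold Act; split <;> exact ⟨Action.S, by simp⟩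

/-- The reward `r(a)`: `r(H) = r_H`, `r(N) = r_N`, `r(S) = r(R) = 0`. -/
noncomputable def rew (rH rN : ℝ) : Action → ℝ
  | Action.H => rH
  | Action.N => rN
  | _ => 0

/-- Expected net immediate reward
`R((q,cog),a) = r(a) − c·E[τ|cog,a]·q − (cλ/2)·E[τ²|cog,a]`. -/
noncomputable def Rimm {C : Type*} (c lam rH rN : ℝ) (Etau Etau2 : C → Action → ℝ)
    (q : ℤ) (cog : C) (a : Action) : ℝ :=
  rew rH rN a - c * Etau cog a * (q : ℝ) - c * lam / 2 * Etau2 cog a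

/-- The Poisson probability of `w` arrivals when the mean number of arrivals is `μ`. -/
noncomputable def poissonPMF (μ : ℝ) (w : ℕ) : ℝ :=
  Real.exp (-μ) * μ ^ w / (w.factorial : ℝ)

/-- The next queue length: `q − 1 + w` under actions `S, N, H` and `q + w` under `R`. -/
def nextQ (a : Action) (q : ℤ) (w : ℕ) : ℤ :=
  if a = Action.R then q + (w : ℤ) else q - 1 + (w : ℤ)

/-- `E[γ^τ | cog, a]`, the expected discount over a sojourn in state `cog` under action `a`. -/
noncomputable def Egamma {C : Type*} [Fintype C] (γ : ℝ) (P : C → Action → ℕ → C → ℝ)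
    (cog : C) (a : Action) : ℝ :=
  ∑' (τ : ℕ), ∑' (cog' : C), γ ^ τ * P cog a τ cog'

/-- The Q-value of action `a` at `(q, cog)` for the continuation value function `V`:
`Q_V(q,cog,a) = R((q,cog),a) + Σ_{τ,cog',w} γ^τ·P(τ,cog'|cog,a)·Poisson(λτ)(w)·V(q',cog')`. -/
noncomputable def Qval {C : Type*} [Fintype C] (c lam rH rN γ : ℝ)
    (Etau Etau2 : C → Action → ℝ) (P : C → Action → ℕ → C → ℝ)
    (V : ℤ → C → ℝ) (q : ℤ) (cog : C) (a : Action) : ℝ :=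
  Rimm c lam rH rN Etau Etau2 q cog a +
    ∑' (τ : ℕ), ∑' (cog' : C), ∑' (w : ℕ),
      γ ^ τ * P cog a τ cog' * poissonPMF (lam * (τ : ℝ)) w * V (nextQ a q w) cog'

/-- `V` satisfies the value-bound property with constants `t_s`, `t_max`, `ρ`:
for all `cog'`, `q` and `Δ ∈ ℕ`,
`c·t_s·Δ/(1 − γ^{t_max}) ≤ V(q,cog') − V(q+Δ,cog') ≤ c·t_max·Δ/(1 − ρ)`. -/
def ValueBound {C : Type*} (c γ ρ : ℝ) (ts tmax : ℕ) (V : ℤ → C → ℝ) : Prop :=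
  ∀ (cog' : C) (q : ℤ) (Δ : ℕ),
    c * (ts : ℝ) * (Δ : ℝ) / (1 - γ ^ tmax) ≤ V q cog' - V (q + (Δ : ℤ)) cog' ∧
    V q cog' - V (q + (Δ : ℤ)) cog' ≤ c * (tmax : ℝ) * (Δ : ℝ) / (1 - ρ)

lemma poissonPMF_nonneg {μ : ℝ} (hμ : 0 ≤ μ) (w : ℕ) : 0 ≤ poissonPMF μ w := by
  unfold poissonPMF; positivity

lemma hasSum_poissonPMF (μ : ℝ) : HasSum (poissonPMF μ) 1 := by
  have h := (NormedSpace.expSeries_div_hasSum_exp μ).mul_left (Real.exp (-μ))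
  rw [← Real.exp_eq_exp_ℝ, ← Real.exp_add, neg_add_cancel, Real.exp_zero] at h
  refine h.congr_fun fun w => ?_
  rw [poissonPMF, mul_div_assoc]

lemma hasSum_poissonPMF_mul_id (μ : ℝ) : HasSum (fun w : ℕ => poissonPMF μ w * w) μ := by
  rw [← hasSum_nat_add_iff' 1]
  have h := (hasSum_poissonPMF μ).mul_left μ
  simp only [Finset.range_one, Finset.sum_singleton, Nat.cast_zero, mul_zero, sub_zero]
  rw [mul_one] at h
  refine h.congr_fun fun w => ?_
  simp only [poissonPMF, Nat.factorial_succ, Nat.cast_mul, pow_succ]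
  have : ((w + 1 : ℕ) : ℝ) ≠ 0 := by positivity
  field_simp

section PoissonExpectation

variable {μ A K : ℝ} {f : ℕ → ℝ}

lemma summable_poissonPMF_mul (hμ : 0 ≤ μ) (hf : ∀ w, |f w| ≤ A + K * w) :
    Summable fun w => poissonPMF μ w * f w := by
  refine Summable.of_norm_bounded
    (((hasSum_poissonPMF μ).mul_left A).add
      ((hasSum_poissonPMF_mul_id μ).mul_left K)).summable fun w => ?_
  rw [Real.norm_eq_abs, abs_mul, abs_of_nonneg (poissonPMF_nonneg hμ w)]
  nlinarith [mul_le_mul_of_nonneg_left (hf w) (poissonPMF_nonneg hμ w)]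

lemma abs_tsum_poissonPMF_mul_le (hμ : 0 ≤ μ) (hf : ∀ w, |f w| ≤ A + K * w) :
    |∑' w, poissonPMF μ w * f w| ≤ A + K * μ := by
  have h := ((hasSum_poissonPMF μ).mul_left A).add ((hasSum_poissonPMF_mul_id μ).mul_left K)
  rw [mul_one] at h
  rw [← Real.norm_eq_abs]
  refine tsum_of_norm_bounded h fun w => ?_
  rw [Real.norm_eq_abs, abs_mul, abs_of_nonneg (poissonPMF_nonneg hμ w)]
  nlinarith [mul_le_mul_of_nonneg_left (hf w) (poissonPMF_nonneg hμ w)]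

lemma le_tsum_poissonPMF_mul {L : ℝ} (hμ : 0 ≤ μ) (hf : Summable fun w => poissonPMF μ w * f w)
    (hL : ∀ w, L ≤ f w) : L ≤ ∑' w, poissonPMF μ w * f w := by
  have h := (hasSum_poissonPMF μ).mul_right L
  rw [one_mul] at h
  exact hasSum_le (fun w => mul_le_mul_of_nonneg_left (hL w) (poissonPMF_nonneg hμ w)) h hf.hasSum

lemma tsum_poissonPMF_mul_le {U : ℝ} (hμ : 0 ≤ μ) (hf : Summable fun w => poissonPMF μ w * f w)
    (hU : ∀ w, f w ≤ U) : ∑' w, poissonPMF μ w * f w ≤ U := by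
  have h := (hasSum_poissonPMF μ).mul_right U
  rw [one_mul] at h
  exact hasSum_le (fun w => mul_le_mul_of_nonneg_left (hU w) (poissonPMF_nonneg hμ w)) hf.hasSum h

end PoissonExpectation

lemma nextQ_add (a : Action) (q : ℤ) (Δ w : ℕ) : nextQ a (q + Δ) w = nextQ a q w + Δ := by
  unfold nextQ; split <;> ring

lemma nextQ_eq_add (a : Action) (q : ℤ) (w : ℕ) : nextQ a q w = nextQ a q 0 + w := by
  unfold nextQ; split <;> simp

/-- The expected discounted continuation value in `Qval`. -/
noncomputable def continuation {C : Type*} [Fintype C] (lam γ : ℝ) (P : C → Action → ℕ → C → ℝ)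
    (V : ℤ → C → ℝ) (q : ℤ) (cog : C) (a : Action) : ℝ :=
  ∑' (τ : ℕ), ∑' (cog' : C), ∑' (w : ℕ),
    γ ^ τ * P cog a τ cog' * poissonPMF (lam * (τ : ℝ)) w * V (nextQ a q w) cog'

section Continuation

variable {C : Type*} [Fintype C] {lam γ K : ℝ} {P : C → Action → ℕ → C → ℝ}
  {V : ℤ → C → ℝ} {cog : C} {a : Action}

lemma abs_value_nextQ_le (hK : ∀ cog' q (Δ : ℕ), |V q cog' - V (q + Δ) cog'| ≤ K * Δ)
    (q : ℤ) (cog' : C) (w : ℕ) :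
    |V (nextQ a q w) cog'| ≤ (∑ x, |V (nextQ a q 0) x|) + K * w := by
  have h₁ := hK cog' (nextQ a q 0) w
  rw [← nextQ_eq_add] at h₁
  have h₂ := Finset.single_le_sum (f := fun x => |V (nextQ a q 0) x|)
    (fun x _ => abs_nonneg _) (Finset.mem_univ cog')
  have h₃ := abs_sub_abs_le_abs_sub (V (nextQ a q w) cog') (V (nextQ a q 0) cog')
  rw [abs_sub_comm] at h₃
  linarith

lemma summable_sojourn (hP : ∀ τ cog', 0 ≤ P cog a τ cog') (hγ₀ : 0 ≤ γ) (hγ₁ : γ ≤ 1)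
    (hsum : Summable fun τ => ∑ cog', P cog a τ cog')
    (hmean : Summable fun τ : ℕ => (τ : ℝ) * ∑ cog', P cog a τ cog')
    {A B : ℝ} {u : ℕ → C → ℝ} (hu : ∀ τ cog', |u τ cog'| ≤ A + B * τ) :
    Summable fun τ => ∑ cog', γ ^ τ * P cog a τ cog' * u τ cog' := by
  refine Summable.of_norm_bounded ((hsum.mul_left A).add (hmean.mul_left B)) fun τ => ?_
  have hrhs : A * (∑ cog', P cog a τ cog') + B * ((τ : ℝ) * ∑ cog', P cog a τ cog')
      = ∑ cog', P cog a τ cog' * (A + B * τ) := by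
    rw [← Finset.sum_mul]; ring
  rw [hrhs]
  refine (norm_sum_le _ _).trans (Finset.sum_le_sum fun cog' _ => ?_)
  rw [Real.norm_eq_abs, abs_mul, abs_mul, abs_of_nonneg (hP τ cog'),
    abs_of_nonneg (pow_nonneg hγ₀ τ)]
  exact mul_le_mul (mul_le_of_le_one_left (hP τ cog') (pow_le_one₀ hγ₀ hγ₁)) (hu τ cog')
    (abs_nonneg _) (hP τ cog')

lemma continuation_sub_mem_Icc (hP : ∀ τ cog', 0 ≤ P cog a τ cog')
    (hγ₀ : 0 ≤ γ) (hγ₁ : γ ≤ 1) (hlam : 0 ≤ lam)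
    (hsum : Summable fun τ => ∑ cog', P cog a τ cog')
    (hmean : Summable fun τ : ℕ => (τ : ℝ) * ∑ cog', P cog a τ cog')
    (hK : ∀ cog' q (Δ : ℕ), |V q cog' - V (q + Δ) cog'| ≤ K * Δ)
    {Δ : ℕ} {L U : ℝ} (hV : ∀ cog' q, V q cog' - V (q + Δ) cog' ∈ Set.Icc L U) (q : ℤ) :
    continuation lam γ P V q cog a - continuation lam γ P V (q + Δ) cog a ∈
      Set.Icc (Egamma γ P cog a * L) (Egamma γ P cog a * U) := by
  have hμ (τ : ℕ) : 0 ≤ lam * τ := by positivity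
  let u (q : ℤ) (τ : ℕ) (cog' : C) : ℝ :=
    ∑' w, poissonPMF (lam * τ) w * V (nextQ a q w) cog'
  have hcont (q : ℤ) : continuation lam γ P V q cog a
      = ∑' τ, ∑ cog', γ ^ τ * P cog a τ cog' * u q τ cog' := by
    simp only [continuation, tsum_fintype, mul_assoc, tsum_mul_left, u]
  have hsummable (q : ℤ) : Summable fun τ => ∑ cog', γ ^ τ * P cog a τ cog' * u q τ cog' := by
    refine summable_sojourn hP hγ₀ hγ₁ hsum hmean (A := ∑ x, |V (nextQ a q 0) x|)
      (B := K * lam) fun τ cog' => ?_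
    rw [mul_assoc]
    exact abs_tsum_poissonPMF_mul_le (hμ τ) (abs_value_nextQ_le hK q cog')
  have hconst (x : ℝ) : HasSum (fun τ => ∑ cog', γ ^ τ * P cog a τ cog' * x)
      (Egamma γ P cog a * x) := by
    have h := summable_sojourn hP hγ₀ hγ₁ hsum hmean (A := |1|) (B := 0)
      (u := fun _ _ => 1) (by simp)
    simp only [mul_one] at h
    simp only [Egamma, tsum_fintype, ← Finset.sum_mul]
    exact h.hasSum.mul_right x
  have hu (τ : ℕ) (cog' : C) : u q τ cog' - u (q + Δ) τ cog' ∈ Set.Icc L U := by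
    have h₁ := summable_poissonPMF_mul (hμ τ) (abs_value_nextQ_le (a := a) hK q cog')
    have h₂ := summable_poissonPMF_mul (hμ τ) (abs_value_nextQ_le (a := a) hK (q + Δ) cog')
    have h₃ := h₁.sub h₂
    have h₄ := h₁.tsum_sub h₂
    simp only [← mul_sub, nextQ_add] at h₃ h₄
    simp only [u, nextQ_add, ← h₄]
    exact ⟨le_tsum_poissonPMF_mul (hμ τ) h₃ fun w => (hV cog' _).1,
      tsum_poissonPMF_mul_le (hμ τ) h₃ fun w => (hV cog' _).2⟩
  have hdiff := (hsummable q).hasSum.sub (hsummable (q + Δ)).hasSum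
  rw [← hcont, ← hcont] at hdiff
  simp only [← Finset.sum_sub_distrib, ← mul_sub] at hdiff
  have hnn (τ : ℕ) (cog' : C) : 0 ≤ γ ^ τ * P cog a τ cog' :=
    mul_nonneg (pow_nonneg hγ₀ τ) (hP τ cog')
  exact ⟨hasSum_le (fun τ => Finset.sum_le_sum fun cog' _ =>
      mul_le_mul_of_nonneg_left (hu τ cog').1 (hnn τ cog')) (hconst L) hdiff,
    hasSum_le (fun τ => Finset.sum_le_sum fun cog' _ =>
      mul_le_mul_of_nonneg_left (hu τ cog').2 (hnn τ cog')) hdiff (hconst U)⟩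

/-- Jensen's inequality for `x ↦ γ ^ x` and the sojourn time. -/
lemma rpow_mean_le_Egamma (hP : ∀ τ cog', 0 ≤ P cog a τ cog') (hγ₀ : 0 < γ) (hγ₁ : γ ≤ 1)
    (hsum : HasSum (fun τ => ∑ cog', P cog a τ cog') 1) {m : ℝ}
    (hmean : HasSum (fun τ : ℕ => (τ : ℝ) * ∑ cog', P cog a τ cog') m) :
    γ ^ m ≤ Egamma γ P cog a := by
  have htangent := ((hsum.mul_left (1 - Real.log γ * m)).add
    (hmean.mul_left (Real.log γ))).mul_left (γ ^ m)
  have hE := summable_sojourn hP hγ₀.le hγ₁ hsum.summable hmean.summable (A := |1|) (B := 0)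
    (u := fun _ _ => 1) (by simp)
  simp only [mul_one] at hE
  have hle := hasSum_le (fun τ => ?_) htangent hE.hasSum
  · simp only [Egamma, tsum_fintype]
    refine le_trans (le_of_eq ?_) hle
    ring
  · have hexp : γ ^ m * (1 + Real.log γ * (τ - m)) ≤ γ ^ τ := by
      have h := mul_le_mul_of_nonneg_left (Real.add_one_le_exp (Real.log γ * (τ - m)))
        (Real.rpow_nonneg hγ₀.le m)
      rw [← Real.rpow_def_of_pos hγ₀, ← Real.rpow_add hγ₀, add_sub_cancel,
        Real.rpow_natCast] at h
      linarith
    rw [← Finset.mul_sum]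
    refine le_trans (le_of_eq ?_)
      (mul_le_mul_of_nonneg_right hexp (Finset.sum_nonneg fun cog' _ => hP τ cog'))
    ring

end Continuation

/-- for `cog` with `cog ≤ cog*`, if `V` satisfies the value-bound property,
`E[τ|cog,H] > E[τ|cog,N]`, and
`E[τ|cog,H] − E[τ|cog,N] + t_s·γ^{E[τ|cog,H]}/(1−γ^{t_max}) ≥ (t_max/(1−ρ))·E[γ^τ|cog,N]`,
then `q ↦ Q_V(q,cog,N) − Q_V(q,cog,H)` is nondecreasing; consequently once `N` strictly
dominates `H` it does so for all larger queue lengths. -/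
theorem stmt9 {C : Type*} [LinearOrder C] [Fintype C]
    (cogStar : C) (c lam rH rN γ : ℝ) (ts : ℕ)
    (Etau Etau2 : C → Action → ℝ) (P : C → Action → ℕ → C → ℝ)
    (hc : 0 < c) (hlam : 0 < lam) (hγ : γ ∈ Set.Ioo (0 : ℝ) 1)
    (hrN : 0 ≤ rN) (hrHN : rN < rH) (hts : 1 ≤ ts)
    (hPnn : ∀ cog a τ cog', 0 ≤ P cog a τ cog')
    (hP0 : ∀ cog a cog', P cog a 0 cog' = 0)
    (hPsum : ∀ cog, ∀ a ∈ Act cogStar cog, (∑' (τ : ℕ), ∑' (cog' : C), P cog a τ cog') = 1)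
    (hPS : ∀ cog τ cog', τ ≠ ts → P cog Action.S τ cog' = 0)
    (hEtau : ∀ cog a, Etau cog a = ∑' (τ : ℕ), ∑' (cog' : C), (τ : ℝ) * P cog a τ cog')
    (hEtau2 : ∀ cog a, Etau2 cog a = ∑' (τ : ℕ), ∑' (cog' : C), (τ : ℝ) ^ 2 * P cog a τ cog')
    (hMom2 : ∀ cog a, Summable fun τ : ℕ => (τ : ℝ) ^ 2 * ∑' (cog' : C), P cog a τ cog')
    (tmax : ℕ) (htmax : 1 ≤ tmax) (ρ : ℝ) (hρ : ρ ∈ Set.Ioo (0 : ℝ) 1)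
    (hEle : ∀ cog, ∀ a ∈ Act cogStar cog, Etau cog a ≤ (tmax : ℝ))
    (cog : C) (hcog : cog ≤ cogStar)
    (V : ℤ → C → ℝ) (hV : ValueBound c γ ρ ts tmax V)
    (hHN : Etau cog Action.N < Etau cog Action.H)
    (hcond : Etau cog Action.H - Etau cog Action.N
          + (ts : ℝ) * γ ^ Etau cog Action.H / (1 - γ ^ tmax)
        ≥ (tmax : ℝ) / (1 - ρ) * Egamma γ P cog Action.N) :
    Monotone (fun q : ℤ => Qval c lam rH rN γ Etau Etau2 P V q cog Action.N - Qval c lam rH rN γ Etau Etau2 P V q cog Action.H) ∧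
    ∀ q₁ q₂ : ℤ, q₁ ≤ q₂ →
      Qval c lam rH rN γ Etau Etau2 P V q₁ cog Action.H < Qval c lam rH rN γ Etau Etau2 P V q₁ cog Action.N →
      Qval c lam rH rN γ Etau Etau2 P V q₂ cog Action.H < Qval c lam rH rN γ Etau Etau2 P V q₂ cog Action.N := by
  obtain ⟨hγ₀, hγ₁⟩ := hγ
  have hden : 0 < 1 - γ ^ tmax := sub_pos.2 (pow_lt_one₀ hγ₀.le hγ₁ (by omega))
  have hPsum_hasSum (a : Action) (ha : a ∈ Act cogStar cog) :
      HasSum (fun τ => ∑ cog', P cog a τ cog') 1 := by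
    have h := hPsum cog a ha
    simp only [tsum_fintype] at h
    rw [← h]
    refine Summable.hasSum ?_
    by_contra hns
    rw [tsum_eq_zero_of_not_summable hns] at h
    exact zero_ne_one h
  have hmean (a : Action) :
      HasSum (fun τ : ℕ => (τ : ℝ) * ∑ cog', P cog a τ cog') (Etau cog a) := by
    simp only [hEtau, tsum_fintype, ← Finset.mul_sum]
    refine Summable.hasSum ?_
    have h2 := hMom2 cog a
    simp only [tsum_fintype] at h2
    have hnn (τ : ℕ) : 0 ≤ ∑ cog', P cog a τ cog' :=
      Finset.sum_nonneg fun cog' _ => hPnn cog a τ cog'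
    refine Summable.of_nonneg_of_le (fun τ => mul_nonneg τ.cast_nonneg (hnn τ))
      (fun τ => mul_le_mul_of_nonneg_right ?_ (hnn τ)) h2
    exact_mod_cast Nat.le_self_pow two_ne_zero τ
  have hK (cog' : C) (q : ℤ) (Δ : ℕ) :
      |V q cog' - V (q + Δ) cog'| ≤ c * tmax / (1 - ρ) * Δ := by
    obtain ⟨h₁, h₂⟩ := hV cog' q Δ
    rw [abs_of_nonneg (le_trans (by positivity) h₁), div_mul_eq_mul_div]
    exact h₂
  have hNmem : Action.N ∈ Act cogStar cog := by simp [Act, hcog]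
  have hHmem : Action.H ∈ Act cogStar cog := by simp [Act, hcog]
  have hmono : Monotone (fun q : ℤ => Qval c lam rH rN γ Etau Etau2 P V q cog Action.N
      - Qval c lam rH rN γ Etau Etau2 P V q cog Action.H) := by
    intro q₁ q₂ hq
    obtain ⟨Δ, rfl⟩ := Int.le.dest hq
    have hdiff (a : Action) (ha : a ∈ Act cogStar cog) :=
      continuation_sub_mem_Icc (hPnn cog a) hγ₀.le hγ₁.le hlam.le
        (hPsum_hasSum a ha).summable (hmean a).summable hK
        (fun cog' q => hV cog' q Δ) q₁
    have hN := (hdiff _ hNmem).2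
    have hH := (hdiff _ hHmem).1
    have hJensen := rpow_mean_le_Egamma (hPnn cog Action.H) hγ₀ hγ₁.le
      (hPsum_hasSum _ hHmem) (hmean Action.H)
    have hJ := mul_le_mul_of_nonneg_right hJensen
      (show 0 ≤ c * (ts : ℝ) * (Δ : ℝ) / (1 - γ ^ tmax) by positivity)
    have hgap := mul_le_mul_of_nonneg_left hcond (show 0 ≤ c * (Δ : ℝ) by positivity)
    have hgapN : c * (Δ : ℝ) * ((tmax : ℝ) / (1 - ρ) * Egamma γ P cog Action.N)
        = Egamma γ P cog Action.N * (c * (tmax : ℝ) * (Δ : ℝ) / (1 - ρ)) := by ring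
    have hgapH : c * (Δ : ℝ) * (Etau cog Action.H - Etau cog Action.N
          + (ts : ℝ) * γ ^ Etau cog Action.H / (1 - γ ^ tmax))
        = c * (Δ : ℝ) * (Etau cog Action.H - Etau cog Action.N)
          + γ ^ Etau cog Action.H * (c * (ts : ℝ) * (Δ : ℝ) / (1 - γ ^ tmax)) := by ring
    rw [hgapN, hgapH] at hgap
    simp only [continuation] at hN hH
    simp only [Qval, Rimm]
    push_cast at hN hH ⊢
    linarith
  refine ⟨hmono, fun q₁ q₂ hq hdom => ?_⟩
  have := hmono hq
  simp only at this
  linarith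

end Fidelity
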